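/- arXiv:1306.4493 — 3 statements merged into one kernel-verified Lean document; each statement's English description precedes it below -/
import Mathlib

section
/- Let α > 0, n > 0, K_A > 0, K_B > 0, θ_A > 0, θ_B > 0, T > 0. Let x_A, x_B : ℝ → ℝ be continuous with x_A(t) ≥ θ_A and x_B(t) ≥ θ_B for all t ∈ [0, T], and let x_C : ℝ → ℝ be differentiable on [0, T] with x_C'(t) = α·(x_A(t)^n/(K_A^n + x_A(t)^n))·(x_B(t)^n/(K_B^n + x_B(t)^n)) − α·x_C(t) and x_C(0) ≥ 0. Set K* = (θ_A^n/(K_A^n + θ_A^n))·(θ_B^n/(K_B^n + θ_B^n)). Then x_C(t) ≥ K*·(1 − exp(−α·t)) for all t ∈ [0, T]. -/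
open Real Set

lemma hill_mono_aux (n K θ x : ℝ) (hn : 0 < n) (hK : 0 < K) (hθ : 0 < θ) (h : θ ≤ x) :
    θ ^ n / (K ^ n + θ ^ n) ≤ x ^ n / (K ^ n + x ^ n) := by
  have h1 : θ ^ n ≤ x ^ n := Real.rpow_le_rpow hθ.le h hn.le
  have h2 : 0 < K ^ n := Real.rpow_pos_of_pos hK n
  have h3 : 0 < θ ^ n := Real.rpow_pos_of_pos hθ n
  rw [div_le_div_iff₀ (by linarith) (by linarith)]
  nlinarith

/-- Worst-case input for the 'both inputs high' row of the AND gate: if the inputs stay above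
their activation thresholds, the output dominates `K*·(1 − exp(−α·t))`. -/
theorem stmt_12 (α n K_A K_B θ_A θ_B T : ℝ) (hα : 0 < α) (hn : 0 < n)
    (hKA : 0 < K_A) (hKB : 0 < K_B) (hθA : 0 < θ_A) (hθB : 0 < θ_B) (hT : 0 < T)
    (xA xB xC : ℝ → ℝ) (hxA : Continuous xA) (hxB : Continuous xB)
    (hA : ∀ t ∈ Set.Icc (0 : ℝ) T, xA t ≥ θ_A) (hB : ∀ t ∈ Set.Icc (0 : ℝ) T, xB t ≥ θ_B)
    (hode : ∀ t ∈ Set.Icc (0 : ℝ) T,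
      HasDerivWithinAt xC
        (α * (xA t ^ n / (K_A ^ n + xA t ^ n)) * (xB t ^ n / (K_B ^ n + xB t ^ n))
          - α * xC t) (Set.Icc 0 T) t)
    (h0 : xC 0 ≥ 0) :
    ∀ t ∈ Set.Icc (0 : ℝ) T,
      xC t ≥ (θ_A ^ n / (K_A ^ n + θ_A ^ n)) * (θ_B ^ n / (K_B ^ n + θ_B ^ n))
        * (1 - Real.exp (-α * t)) := by
  have pA : 0 ≤ θ_A ^ n / (K_A ^ n + θ_A ^ n) := by positivity
  have pB : 0 ≤ θ_B ^ n / (K_B ^ n + θ_B ^ n) := by positivity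
  have hmA := fun t ht => hill_mono_aux n K_A θ_A (xA t) hn hKA hθA (hA t ht)
  have hmB := fun t ht => hill_mono_aux n K_B θ_B (xB t) hn hKB hθB (hB t ht)
  generalize θ_A ^ n / (K_A ^ n + θ_A ^ n) = a at *
  generalize θ_B ^ n / (K_B ^ n + θ_B ^ n) = b at *
  have hd : ∀ t ∈ Set.Icc (0 : ℝ) T,
      HasDerivWithinAt (fun t => Real.exp (α * t) * (xC t - a * b))
        (α * Real.exp (α * t) * ((xA t ^ n / (K_A ^ n + xA t ^ n))
          * (xB t ^ n / (K_B ^ n + xB t ^ n)) - a * b)) (Set.Icc 0 T) t := by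
    intro t ht
    have he : HasDerivAt (fun t : ℝ => Real.exp (α * t)) (Real.exp (α * t) * (α * 1)) t :=
      ((hasDerivAt_id t).const_mul α).exp
    have := he.hasDerivWithinAt.mul ((hode t ht).sub_const (a * b))
    refine this.congr_deriv ?_
    ring
  have hmono := monotoneOn_of_hasDerivWithinAt_nonneg (convex_Icc (0 : ℝ) T)
    (fun t ht => (hd t ht).continuousWithinAt)
    (fun t ht => (hd t (interior_subset ht)).mono interior_subset)
    (fun t ht => by
      have h1 := hmA t (interior_subset ht)
      have h2 := hmB t (interior_subset ht)
      have h3 := mul_le_mul h1 h2 pB (pA.trans h1)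
      exact mul_nonneg (by positivity) (sub_nonneg.2 h3))
  intro t ht
  have hm := hmono (Set.left_mem_Icc.2 hT.le) ht ht.1
  simp only [mul_zero, Real.exp_zero, one_mul] at hm
  have hm2 : -(a * b) ≤ Real.exp (α * t) * (xC t - a * b) := by linarith
  have he : Real.exp (-α * t) * Real.exp (α * t) = 1 := by
    rw [← Real.exp_add]; simp
  have h4 := mul_le_mul_of_nonneg_left hm2 (Real.exp_pos (-α * t)).le
  rw [← mul_assoc, he] at h4
  linarith
end

section
/- Let n > 0, θ̃ ∈ (0, 1), θ_A > 0, θ_B > 0, and K_AC, K_BC ≥ 0. Then (θ_A^n/(K_AC^n + θ_A^n))·(θ_B^n/(K_BC^n + θ_B^n)) ≥ θ̃ if and only if both K_BC^n ≤ θ_B^n·(1 − θ̃)/θ̃ and K_AC^n ≤ θ_A^n·( θ_B^n/(θ̃·(K_BC^n + θ_B^n)) − 1 ). -/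
open Real

/-- Method 2, Case 1 exact characterization for the AND gate: the steady-state product of
Hill functions exceeds `θ̃` iff both bounds on `K_BC` and `K_AC` hold. -/
theorem stmt_16 (n θt θ_A θ_B K_AC K_BC : ℝ) (hn : 0 < n) (hθt0 : 0 < θt) (hθt1 : θt < 1)
    (hθA : 0 < θ_A) (hθB : 0 < θ_B) (hKAC : 0 ≤ K_AC) (hKBC : 0 ≤ K_BC) :
    (θ_A ^ n / (K_AC ^ n + θ_A ^ n)) * (θ_B ^ n / (K_BC ^ n + θ_B ^ n)) ≥ θt ↔
      K_BC ^ n ≤ θ_B ^ n * (1 - θt) / θt ∧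
        K_AC ^ n ≤ θ_A ^ n * (θ_B ^ n / (θt * (K_BC ^ n + θ_B ^ n)) - 1) := by
  have ha : 0 < θ_A ^ n := Real.rpow_pos_of_pos hθA n
  have hb : 0 < θ_B ^ n := Real.rpow_pos_of_pos hθB n
  have hx : 0 ≤ K_AC ^ n := Real.rpow_nonneg hKAC n
  have hy : 0 ≤ K_BC ^ n := Real.rpow_nonneg hKBC n
  generalize θ_A ^ n = a at *
  generalize θ_B ^ n = b at *
  generalize K_AC ^ n = x at *
  generalize K_BC ^ n = y at *
  have hyb : 0 < y + b := by linarith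
  have hxa : 0 < x + a := by linarith
  have h1 : (a / (x + a)) * (b / (y + b)) ≥ θt ↔ θt * ((x + a) * (y + b)) ≤ a * b := by
    rw [div_mul_div_comm, ge_iff_le, le_div_iff₀ (mul_pos hxa hyb)]
  have h2 : x ≤ a * (b / (θt * (y + b)) - 1) ↔ θt * ((x + a) * (y + b)) ≤ a * b := by
    have e : a * (b / (θt * (y + b)) - 1) = a * b / (θt * (y + b)) - a := by ring
    rw [e, le_sub_iff_add_le, le_div_iff₀ (mul_pos hθt0 hyb)]
    have e2 : (x + a) * (θt * (y + b)) = θt * ((x + a) * (y + b)) := by ring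
    rw [e2]
  rw [h1, h2, le_div_iff₀ hθt0]
  refine ⟨fun h => ⟨?_, h⟩, fun h => h.2⟩
  have h3 : a * (θt * (y + b)) ≤ a * b := by
    have : 0 ≤ x * (θt * (y + b)) := by positivity
    nlinarith
  have h4 := le_of_mul_le_mul_left h3 ha
  linarith
end

section
/- Let n > 0, 0 < θ_B₋ < θ_B₊, θ̃₋, θ̃₊ ∈ (0, 1), and K > 0. Then the two conditions 1/(1 + (θ_B₋/K)^n) ≥ θ̃₊ and 1/(1 + (θ_B₊/K)^n) ≤ θ̃₋ hold simultaneously if and only if θ_B₋·(θ̃₊/(1 − θ̃₊))^{1/n} ≤ K ≤ θ_B₊·(θ̃₋/(1 − θ̃₋))^{1/n}. Moreover, this interval is nonempty if and only if n ≥ (1/log(θ_B₊/θ_B₋))·log( (θ̃₊/θ̃₋)·(1 − θ̃₋)/(1 − θ̃₊) ), provided (θ̃₊/θ̃₋)·(1 − θ̃₋)/(1 − θ̃₊) ≥ 1. -/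
open Real

lemma aux_log_mul (n x t : ℝ) (hx : 0 < x) (ht0 : 0 < t) (ht1 : t < 1) :
    Real.log (x * (t / (1 - t)) ^ (1 / n)) =
      Real.log x + (Real.log t - Real.log (1 - t)) / n := by
  have h1 : 0 < 1 - t := by linarith
  have h2 : 0 < t / (1 - t) := div_pos ht0 h1
  rw [Real.log_mul hx.ne' (Real.rpow_pos_of_pos h2 _).ne', Real.log_rpow h2,
    Real.log_div ht0.ne' h1.ne']
  ring

lemma aux_pos (n x t : ℝ) (hx : 0 < x) (ht0 : 0 < t) (ht1 : t < 1) :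
    0 < x * (t / (1 - t)) ^ (1 / n) :=
  mul_pos hx (Real.rpow_pos_of_pos (div_pos ht0 (by linarith)) _)

lemma aux_log_pow (n x K : ℝ) (hx : 0 < x) (hK : 0 < K) :
    Real.log ((x / K) ^ n) = n * (Real.log x - Real.log K) := by
  rw [Real.log_rpow (div_pos hx hK), Real.log_div hx.ne' hK.ne']

lemma aux_ge (n x K t : ℝ) (hn : 0 < n) (hx : 0 < x) (hK : 0 < K) (ht0 : 0 < t) (ht1 : t < 1) :
    1 / (1 + (x / K) ^ n) ≥ t ↔ x * (t / (1 - t)) ^ (1 / n) ≤ K := by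
  have h1 : 0 < 1 - t := by linarith
  have hp : 0 < (x / K) ^ n := Real.rpow_pos_of_pos (div_pos hx hK) _
  have e1 : 1 / (1 + (x / K) ^ n) ≥ t ↔ (x / K) ^ n ≤ (1 - t) / t := by
    rw [ge_iff_le, le_div_iff₀ (by positivity), le_div_iff₀ ht0]
    constructor <;> intro h <;> linarith
  rw [e1, ← Real.log_le_log_iff hp (div_pos h1 ht0), aux_log_pow n x K hx hK,
    Real.log_div h1.ne' ht0.ne', ← Real.log_le_log_iff (aux_pos n x t hx ht0 ht1) hK,
    aux_log_mul n x t hx ht0 ht1, ← le_sub_iff_add_le', div_le_iff₀ hn]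
  constructor <;> intro h <;> linarith

lemma aux_le (n x K t : ℝ) (hn : 0 < n) (hx : 0 < x) (hK : 0 < K) (ht0 : 0 < t) (ht1 : t < 1) :
    1 / (1 + (x / K) ^ n) ≤ t ↔ K ≤ x * (t / (1 - t)) ^ (1 / n) := by
  have h1 : 0 < 1 - t := by linarith
  have hp : 0 < (x / K) ^ n := Real.rpow_pos_of_pos (div_pos hx hK) _
  have e1 : 1 / (1 + (x / K) ^ n) ≤ t ↔ (1 - t) / t ≤ (x / K) ^ n := by
    rw [div_le_iff₀ (by positivity), div_le_iff₀ ht0]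
    constructor <;> intro h <;> linarith
  rw [e1, ← Real.log_le_log_iff (div_pos h1 ht0) hp, aux_log_pow n x K hx hK,
    Real.log_div h1.ne' ht0.ne', ← Real.log_le_log_iff hK (aux_pos n x t hx ht0 ht1),
    aux_log_mul n x t hx ht0 ht1, ← sub_le_iff_le_add', le_div_iff₀ hn]
  constructor <;> intro h <;> linarith

/-- NOT-gate parameter synthesis: the two Hill-repression conditions hold iff the repression
threshold `K` lies in an explicit interval, and that interval is nonempty iff the Hill
coefficient `n` exceeds an explicit lower bound (under the stated proviso). -/
theorem stmt_18 (n θBm θBp θtm θtp K : ℝ) (hn : 0 < n) (hθBm : 0 < θBm) (hθB : θBm < θBp)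
    (hθtm0 : 0 < θtm) (hθtm1 : θtm < 1) (hθtp0 : 0 < θtp) (hθtp1 : θtp < 1) (hK : 0 < K) :
    ((1 / (1 + (θBm / K) ^ n) ≥ θtp ∧ 1 / (1 + (θBp / K) ^ n) ≤ θtm) ↔
      (θBm * (θtp / (1 - θtp)) ^ (1 / n) ≤ K ∧ K ≤ θBp * (θtm / (1 - θtm)) ^ (1 / n))) ∧
    ((θtp / θtm) * ((1 - θtm) / (1 - θtp)) ≥ 1 →
      (θBm * (θtp / (1 - θtp)) ^ (1 / n) ≤ θBp * (θtm / (1 - θtm)) ^ (1 / n) ↔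
        n ≥ (1 / Real.log (θBp / θBm)) *
          Real.log ((θtp / θtm) * ((1 - θtm) / (1 - θtp))))) := by
  have hBp : 0 < θBp := hθBm.trans hθB
  refine ⟨and_congr (aux_ge n θBm K θtp hn hθBm hK hθtp0 hθtp1)
    (aux_le n θBp K θtm hn hBp hK hθtm0 hθtm1), fun _ => ?_⟩
  have h1 : 0 < 1 - θtm := by linarith
  have h2 : 0 < 1 - θtp := by linarith
  have hL : 0 < Real.log (θBp / θBm) := Real.log_pos ((one_lt_div hθBm).2 hθB)
  rw [← Real.log_le_log_iff (aux_pos n θBm θtp hθBm hθtp0 hθtp1)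
      (aux_pos n θBp θtm hBp hθtm0 hθtm1), aux_log_mul n θBm θtp hθBm hθtp0 hθtp1,
    aux_log_mul n θBp θtm hBp hθtm0 hθtm1, ge_iff_le, one_div_mul_eq_div, div_le_iff₀ hL,
    Real.log_mul (div_pos hθtp0 hθtm0).ne' (div_pos h1 h2).ne',
    Real.log_div hθtp0.ne' hθtm0.ne', Real.log_div h1.ne' h2.ne',
    Real.log_div hBp.ne' hθBm.ne', ← sub_nonneg, ← mul_nonneg_iff_of_pos_left hn]
  have e : n * (Real.log θBp + (Real.log θtm - Real.log (1 - θtm)) / n -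
      (Real.log θBm + (Real.log θtp - Real.log (1 - θtp)) / n)) =
      n * (Real.log θBp - Real.log θBm) + (Real.log θtm - Real.log (1 - θtm))
        - (Real.log θtp - Real.log (1 - θtp)) := by
    field_simp
    ring
  rw [e]
  constructor <;> intro h <;> linarith
end
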